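/- If every cycle of a finite simple graph G is odd, then every block of G is either an edge or a single cycle (i.e., no two distinct cycles share an edge). -/

import Mathlib

namespace SimpleGraph.Walk

variable {V : Type*} {G : SimpleGraph V}

/-- A cycle splits, at any two distinct vertices, into two paths that meet only at their ends. -/
lemma IsCycle.exists_isPath_isPath [DecidableEq V] {u x y : V} {C : G.Walk u u}
    (hC : C.IsCycle) (hx : x ∈ C.support) (hy : y ∈ C.support) (hxy : x ≠ y) :
    ∃ (p : G.Walk x y) (q : G.Walk y x), p.IsPath ∧ q.IsPath ∧
      p.length + q.length = C.length ∧
      (∀ e, e ∈ C.edges ↔ e ∈ p.edges ∨ e ∈ q.edges) ∧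
      (∀ w, w ∈ p.support → w ∈ C.support) ∧ (∀ w, w ∈ q.support → w ∈ C.support) := by
  have hD : (C.rotate x hx).IsCycle := hC.rotate hx
  have hmem : ∀ w, w ∈ (C.rotate x hx).support ↔ w ∈ C.support :=
    fun w => mem_support_rotate_iff C x hx
  have hyD : y ∈ (C.rotate x hx).support := (hmem y).2 hy
  have hspec := take_spec (C.rotate x hx) hyD
  refine ⟨(C.rotate x hx).takeUntil y hyD, (C.rotate x hx).dropUntil y hyD,
    hD.isPath_takeUntil hyD, ?_, ?_, fun e => ?_,
    fun w hw => (hmem w).1 (support_takeUntil_subset_support _ _ hw),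
    fun w hw => (hmem w).1 (support_dropUntil_subset_support _ _ hw)⟩
  · exact IsCycle.isPath_of_append_right (not_nil_of_ne hxy) (hspec ▸ hD)
  · rw [← length_append, hspec, length_rotate]
  · rw [← List.mem_append, ← edges_append, hspec]
    exact (rotate_edges C x hx).mem_iff.symm

/-- An edge of a path with both ends in `S` lies on a subpath with distinct ends in `S` and
no interior vertex in `S`. -/
lemma IsPath.exists_isPath_interior_notMem {S : Set V} {e : Sym2 V} {x y : V} {p : G.Walk x y}
    (hp : p.IsPath) (hx : x ∈ S) (hy : y ∈ S) (he : e ∈ p.edges) :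
    ∃ (a b : V) (q : G.Walk a b), q.IsPath ∧ a ≠ b ∧ a ∈ S ∧ b ∈ S ∧ e ∈ q.edges ∧
      ∀ w ∈ q.support, w ∈ S → w = a ∨ w = b := by
  classical
  induction hn : p.length using Nat.strong_induction_on generalizing x y with
  | _ n ih =>
  by_cases! h : ∀ w ∈ p.support, w ∈ S → w = x ∨ w = y
  · refine ⟨x, y, p, hp, ?_, hx, hy, he, h⟩
    rintro rfl
    simp [(isPath_iff_nil.1 hp).eq_nil] at he
  · obtain ⟨w, hw, hwS, hwx, hwy⟩ := h
    rw [← take_spec p hw, edges_append, List.mem_append] at he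
    obtain he | he := he
    · exact ih _ (hn ▸ length_takeUntil_lt_length hw hwy) (hp.takeUntil hw) hx hwS he rfl
    · exact ih _ (hn ▸ length_dropUntil_lt_length hw hwx) (hp.dropUntil hw) hwS hy he rfl

/-- Two paths between the same ends that meet only there form a cycle, provided some edge of one
is not an edge of the other. -/
lemma IsPath.isCycle_append_of_notMem_edges {x y : V} {p : G.Walk x y} {q : G.Walk y x}
    (hp : p.IsPath) (hq : q.IsPath) (h : ∀ w ∈ p.support, w ∈ q.support → w = x ∨ w = y)
    {e : Sym2 V} (hep : e ∈ p.edges) (heq : e ∉ q.edges) (hxy : x ≠ y) :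
    (p.append q).IsCycle := by
  refine hp.isCycle_append hq ?_ ?_
  · intro w hwp hwq
    have hpn := hp.support_nodup
    have hqn := hq.support_nodup
    rw [← cons_tail_support, List.nodup_cons] at hpn hqn
    rcases h w (List.mem_of_mem_tail hwp) (List.mem_of_mem_tail hwq) with rfl | rfl
    · exact hpn.1 hwp
    · exact hqn.1 hwq
  · by_contra! hlen
    cases p with
    | nil => exact hxy rfl
    | cons hadj p =>
      cases p with
      | cons => simp at hlen
      | nil =>
        cases q with
        | nil => exact hxy rfl
        | cons hadj' q =>
          cases q with
          | cons => simp at hlen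
          | nil => simp_all [Sym2.eq_swap]

/-- If all cycles are odd, a cycle through two distinct vertices of another cycle contains no edge
outside it. -/
lemma IsCycle.edges_subset_of_forall_odd
    (hodd : ∀ (z : V) (w : G.Walk z z), w.IsCycle → Odd w.length)
    {u v x y : V} {C : G.Walk u u} {D : G.Walk v v} (hC : C.IsCycle) (hD : D.IsCycle)
    (hxy : x ≠ y) (hxC : x ∈ C.support) (hyC : y ∈ C.support)
    (hxD : x ∈ D.support) (hyD : y ∈ D.support) : D.edges ⊆ C.edges := by
  classical
  intro e heD
  by_contra heC
  obtain ⟨p, q, hp, hq, -, hpq, -, -⟩ := hD.exists_isPath_isPath hxD hyD hxy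
  obtain ⟨a, b, r, hr, hab, ha, hb, her, hrC⟩ :
      ∃ (a b : V) (r : G.Walk a b), r.IsPath ∧ a ≠ b ∧ a ∈ {w | w ∈ C.support} ∧
        b ∈ {w | w ∈ C.support} ∧ e ∈ r.edges ∧
        ∀ w ∈ r.support, w ∈ {w | w ∈ C.support} → w = a ∨ w = b := by
    rcases (hpq e).1 heD with he | he
    · exact hp.exists_isPath_interior_notMem hxC hyC he
    · exact hq.exists_isPath_interior_notMem hyC hxC he
  obtain ⟨s, t, hs, ht, hlen, hst, hsC, htC⟩ := hC.exists_isPath_isPath ha hb hab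
  rw [hst, not_or] at heC
  have h₁ := hodd _ _ (hr.isCycle_append_of_notMem_edges ht
    (fun w hw hw' => hrC w hw (htC w hw')) her heC.2 hab)
  have h₂ := hodd _ _ (hr.isCycle_append_of_notMem_edges hs.reverse
    (fun w hw hw' => hrC w hw (hsC w (by simpa using hw'))) her (by simpa using heC.1) hab)
  have h₃ := hodd _ _ hC
  rw [← hlen] at h₃
  simp only [length_append, length_reverse] at h₁ h₂
  grind

end SimpleGraph.Walk

/-- If every cycle of a finite simple graph `G` is odd, then no two
distinct cycles share an edge (so every block of `G` is an edge or a single cycle). -/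
theorem stmt_8 {V : Type*} [Fintype V] [DecidableEq V] (G : SimpleGraph V)
    (hodd : ∀ (z : V) (w : G.Walk z z), w.IsCycle → Odd w.length)
    (u v : V) (C₁ : G.Walk u u) (C₂ : G.Walk v v)
    (hC₁ : C₁.IsCycle) (hC₂ : C₂.IsCycle)
    (hne : C₁.edges.toFinset ≠ C₂.edges.toFinset) :
    ∀ e : Sym2 V, ¬(e ∈ C₁.edges ∧ e ∈ C₂.edges) := by
  rintro ⟨x, y⟩ ⟨h₁, h₂⟩
  have hxy : x ≠ y := (C₁.adj_of_mem_edges h₁).ne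
  have hx₁ := C₁.fst_mem_support_of_mem_edges h₁
  have hy₁ := C₁.snd_mem_support_of_mem_edges h₁
  have hx₂ := C₂.fst_mem_support_of_mem_edges h₂
  have hy₂ := C₂.snd_mem_support_of_mem_edges h₂
  refine hne (Finset.Subset.antisymm ?_ ?_) <;> intro e <;> simp only [List.mem_toFinset]
  · exact fun he => hC₂.edges_subset_of_forall_odd hodd hC₁ hxy hx₂ hy₂ hx₁ hy₁ he
  · exact fun he => hC₁.edges_subset_of_forall_odd hodd hC₂ hxy hx₁ hy₁ hx₂ hy₂ he
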